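/- Let m > 0 and μ > 0 be real. Define ψ(k) = H_{k−1} − γ for positive integers k, where H_k = ∑_{j=1}^{k} 1/j and γ is the Euler–Mascheroni constant, and define for n ∈ ℕ: Mφφ(n) = (1/(2π²))·(m/2)^(2n+2)·(log(mμ/2) + ψ(2n+2) − (1/2)·(ψ(n+1) + ψ(n+2)))·C(2n+1, n+1) and Mππ(n) = (1/π²)·(m/2)^(2n+4)·(log(mμ/2) + ψ(2n+2) − (1/2)·(ψ(n+1) + ψ(n+3)))·((2n+1)!/(n!·(n+2)!)). Then for every n ∈ ℕ: m²·Mφφ(n) = Mππ(n) + Mφφ(n+1). -/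

import Mathlib

open Finset

/-- The digamma value at a positive integer: `ψ(k) = H_{k−1} − γ`, where `H_k` is the
`k`-th harmonic number and `γ` is the Euler–Mascheroni constant. -/
noncomputable def digammaNat (k : ℕ) : ℝ :=
  (∑ j ∈ Finset.Icc 1 (k - 1), (1 : ℝ) / j) - Real.eulerMascheroniConstant

theorem digammaNat_add_two (k : ℕ) :
    digammaNat (k + 2) = digammaNat (k + 1) + 1 / ((k : ℝ) + 1) := by
  simp only [digammaNat, show k + 2 - 1 = k + 1 by omega, Nat.add_sub_cancel,
    Finset.sum_Icc_succ_top (show 1 ≤ k + 1 by omega)]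
  push_cast
  ring

/-- Section 4.2 of the paper. The moments of the massive vacuum state
on Minkowski spacetime satisfy the static moment dynamics
`−m²·Mφφ(n) + Mππ(n) + Mφφ(n+1) = 0`. -/
theorem minkowski_vacuum_moments_static
    (m μ : ℝ) (hm : 0 < m) (hμ : 0 < μ)
    (Mφφ Mππ : ℕ → ℝ)
    (hφφ : ∀ n : ℕ, Mφφ n = (1 / (2 * Real.pi ^ 2)) * (m / 2) ^ (2 * n + 2) *
      (Real.log (m * μ / 2) + digammaNat (2 * n + 2)
        - (1 / 2) * (digammaNat (n + 1) + digammaNat (n + 2)))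
      * (Nat.choose (2 * n + 1) (n + 1) : ℝ))
    (hππ : ∀ n : ℕ, Mππ n = (1 / Real.pi ^ 2) * (m / 2) ^ (2 * n + 4) *
      (Real.log (m * μ / 2) + digammaNat (2 * n + 2)
        - (1 / 2) * (digammaNat (n + 1) + digammaNat (n + 3)))
      * ((Nat.factorial (2 * n + 1) : ℝ)
          / ((Nat.factorial n : ℝ) * (Nat.factorial (n + 2) : ℝ)))) :
    ∀ n : ℕ, m ^ 2 * Mφφ n = Mππ n + Mφφ (n + 1) := by
  intro n
  have hψ_even₁ := digammaNat_add_two (2 * n + 1)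
  have hψ_even₂ := digammaNat_add_two (2 * n + 2)
  have hψ_succ₁ := digammaNat_add_two n
  have hψ_succ₂ := digammaNat_add_two (n + 1)
  push_cast at hψ_even₁ hψ_even₂ hψ_succ₂
  have hchoose : (Nat.choose (2 * n + 1) (n + 1) : ℝ)
      = (2 * n + 1).factorial / ((n + 1).factorial * n.factorial) := by
    rw [Nat.cast_choose ℝ (by omega), show 2 * n + 1 - (n + 1) = n by omega]
  have hchoose_succ : (Nat.choose (2 * n + 3) (n + 2) : ℝ)
      = (2 * n + 3).factorial / ((n + 2).factorial * (n + 1).factorial) := by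
    rw [Nat.cast_choose ℝ (by omega), show 2 * n + 3 - (n + 2) = n + 1 by omega]
  rw [hφφ, hππ, hφφ, hchoose, show 2 * (n + 1) + 1 = 2 * n + 3 by ring,
    show 2 * (n + 1) + 2 = 2 * n + 2 + 2 by ring, show n + 1 + 1 = n + 2 by ring,
    show n + 1 + 2 = n + 3 by ring, hchoose_succ, hψ_even₂,
    show 2 * n + 2 + 1 = 2 * n + 1 + 2 by ring, hψ_even₁,
    show n + 3 = n + 1 + 2 by ring, hψ_succ₂,
    show n + 1 + 1 = n + 2 by ring, hψ_succ₁,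
    show 2 * n + 1 + 1 = 2 * n + 2 by ring]
  have hn_fact : (n.factorial : ℝ) ≠ 0 := by positivity
  simp only [Nat.factorial_succ]
  push_cast
  generalize digammaNat (2 * n + 2) = x
  generalize digammaNat (n + 1) = y
  generalize Real.log (m * μ / 2) = L
  field_simp
  ring
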